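/- arXiv:1211.4245 — 4 statements merged into one kernel-verified Lean document; each statement's English description precedes it below -/
import Mathlib

section
/- Let G be a finitely generated group, let f be an automorphism of G, and let H be a subgroup of G of finite index. Then there exists a positive integer n such that the n-th iterate of f maps H onto itself, i.e. (f^n)(H) = H. -/
theorem MonoidHom.finite_of_group_fg (G P : Type*) [Group G] [Group.FG G] [Group P] [Finite P] :
    Finite (G →* P) := by
  obtain ⟨S, hS, hfin⟩ := Group.fg_iff.mp ‹Group.FG G›
  have := hfin.to_subtype
  refine Finite.of_injective (fun (φ : G →* P) (s : S) => φ s) fun φ ψ h => ?_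
  exact MonoidHom.eq_of_eqOn_dense hS fun s hs => congrFun h ⟨s, hs⟩

theorem Subgroup.finite_setOf_index_eq (G : Type*) [Group G] [Group.FG G] {n : ℕ} (hn : n ≠ 0) :
    {K : Subgroup G | K.index = n}.Finite := by
  have := MonoidHom.finite_of_group_fg G (Equiv.Perm (Fin n))
  refine (Set.finite_range fun p : (G →* Equiv.Perm (Fin n)) × Fin n =>
    (MulAction.stabilizer (Equiv.Perm (Fin n)) p.2).comap p.1).subset fun K hK => ?_
  have : K.FiniteIndex := ⟨fun h => hn (hK.symm.trans h)⟩
  let e : G ⧸ K ≃ Fin n := Finite.equivFinOfCardEq hK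
  refine ⟨⟨e.permCongrHom.toMonoidHom.comp (MulAction.toPermHom G (G ⧸ K)), e (1 : G)⟩, ?_⟩
  ext g
  simp [MulAction.mem_stabilizer_iff, Equiv.permCongrHom, QuotientGroup.eq]

/-- If `G` is a finitely generated group, `f` an automorphism of `G`
and `H` a finite-index subgroup, then some positive iterate `f^n` maps `H` onto itself. -/
theorem exists_pow_automorphism_map_eq {G : Type*} [Group G] [Group.FG G]
    (f : MulAut G) (H : Subgroup G) [H.FiniteIndex] :
    ∃ n : ℕ, 0 < n ∧ Subgroup.map (f ^ n : MulAut G).toMonoidHom H = H := by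
  obtain ⟨i, j, hij, h⟩ := (Subgroup.finite_setOf_index_eq G
    H.index_ne_zero_of_finite).exists_lt_map_eq_of_forall_mem
    (f := fun k : ℕ => H.map (f ^ k : MulAut G).toMonoidHom)
    fun k => Subgroup.index_map_equiv H (f ^ k)
  refine ⟨j - i, Nat.sub_pos_of_lt hij, ?_⟩
  apply Subgroup.map_injective (f := (f ^ i : MulAut G).toMonoidHom) (f ^ i : MulAut G).injective
  have hcomp : (f ^ i : MulAut G).toMonoidHom.comp (f ^ (j - i) : MulAut G).toMonoidHom =
      (f ^ j : MulAut G).toMonoidHom := by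
    rw [← pow_mul_pow_sub f hij.le]
    rfl
  exact (Subgroup.map_map _ _ _).trans ((congrArg (H.map ·) hcomp).trans h.symm)
end

section
/- Let Y be a topological space, f : Y ≃ₜ Y a homeomorphism, and k a positive integer. Let ℤ act on Y × ℝ by n • (y, t) = (fⁿ(y), t + n), and let Q_k denote the quotient of Y × ℝ by the restriction of this action to the subgroup kℤ. Then: (1) Q_k is homeomorphic to the mapping torus M_{f^k} of the k-th iterate f^k (via the rescaling (y, t) ↦ (y, t/k)); and (2) the identity map of Y × ℝ descends to a continuous map Q_k → M_f which is a covering map, each of whose fibers has exactly k elements. In other words, the mapping torus of f^k is a k-fold cyclic cover of the mapping torus of f. -/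
/-- The orbit relation on `Y × ℝ` of the `ℤ`-action `n • (y, t) = (eⁿ y, t + n)`
associated with a self-bijection `e` of `Y`; for `e = f.toEquiv` the quotient
`Quot (torusRel e)` is the mapping torus `M_f`. -/
def torusRel {Y : Type*} (e : Equiv.Perm Y) (p q : Y × ℝ) : Prop :=
  ∃ n : ℤ, q = ((e ^ n) p.1, p.2 + n)

/-- The relation on `Y × ℝ` given by restricting the above `ℤ`-action to the subgroup
`kℤ ≤ ℤ`: `m • (y, t) = (f^(k m) y, t + k m)`. -/
def torusSubRel {Y : Type*} (e : Equiv.Perm Y) (k : ℕ) (p q : Y × ℝ) : Prop :=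
  ∃ m : ℤ, q = ((e ^ ((k : ℤ) * m)) p.1, p.2 + (k : ℤ) * m)

section MappingTorus

variable {Y : Type*}

theorem torusSubRel_equivalence (e : Equiv.Perm Y) (k : ℕ) : Equivalence (torusSubRel e k) where
  refl p := ⟨0, by simp⟩
  symm := by
    rintro p _ ⟨m, rfl⟩
    refine ⟨-m, Prod.ext ?_ ?_⟩
    · simp
    · push_cast; ring
  trans := by
    rintro p _ _ ⟨m, rfl⟩ ⟨n, rfl⟩
    refine ⟨m + n, Prod.ext ?_ ?_⟩
    · simp only [← Equiv.Perm.mul_apply, ← zpow_add]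
      congr 2; ring
    · push_cast; ring

theorem torusRel_eq_torusSubRel_one (e : Equiv.Perm Y) : torusRel e = torusSubRel e 1 := by
  funext p q
  simp [torusRel, torusSubRel]

theorem torusRel_equivalence (e : Equiv.Perm Y) : Equivalence (torusRel e) :=
  torusRel_eq_torusSubRel_one e ▸ torusSubRel_equivalence e 1

theorem torusRel_of_torusSubRel {e : Equiv.Perm Y} {k : ℕ} {p q : Y × ℝ}
    (h : torusSubRel e k p q) : torusRel e p q := by
  obtain ⟨m, rfl⟩ := h
  exact ⟨k * m, by push_cast; rfl⟩

theorem torusRel_pow_div {e : Equiv.Perm Y} {k : ℕ} (hk : 0 < k) {p q : Y × ℝ}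
    (h : torusSubRel e k p q) : torusRel (e ^ k) (p.1, p.2 / (k : ℝ)) (q.1, q.2 / (k : ℝ)) := by
  obtain ⟨m, rfl⟩ := h
  have : (k : ℝ) ≠ 0 := by positivity
  refine ⟨m, Prod.ext ?_ ?_⟩
  · simp [zpow_mul]
  · field_simp
    push_cast
    ring

theorem torusSubRel_mul {e : Equiv.Perm Y} {k : ℕ} {p q : Y × ℝ}
    (h : torusRel (e ^ k) p q) : torusSubRel e k (p.1, p.2 * (k : ℝ)) (q.1, q.2 * (k : ℝ)) := by
  obtain ⟨m, rfl⟩ := h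
  refine ⟨m, Prod.ext ?_ ?_⟩
  · simp [zpow_mul]
  · push_cast
    ring

/-- The homeomorphism from the quotient of `Y × ℝ` by `kℤ` to the mapping torus of the `k`-th
iterate, given by `(y, t) ↦ (y, t / k)`. -/
noncomputable def torusRescale [TopologicalSpace Y] (e : Equiv.Perm Y) {k : ℕ} (hk : 0 < k) :
    Quot (torusSubRel e k) ≃ₜ Quot (torusRel (e ^ k)) where
  toFun := Quot.map (fun p => (p.1, p.2 / (k : ℝ))) fun _ _ => torusRel_pow_div hk
  invFun := Quot.map (fun p => (p.1, p.2 * (k : ℝ))) fun _ _ => torusSubRel_mul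
  left_inv := by
    have : (k : ℝ) ≠ 0 := by positivity
    rintro ⟨p⟩
    simp [Quot.map, this]
  right_inv := by
    have : (k : ℝ) ≠ 0 := by positivity
    rintro ⟨p⟩
    simp [Quot.map, this]
  continuous_toFun := continuous_quot_lift _ (continuous_quot_mk.comp (by fun_prop))
  continuous_invFun := continuous_quot_lift _ (continuous_quot_mk.comp (by fun_prop))

/-- The generator `(y, t) ↦ (e y, t + 1)` of the `ℤ`-action on `Y × ℝ`. -/
noncomputable def torusShift (e : Equiv.Perm Y) : Equiv.Perm (Y × ℝ) :=
  Equiv.prodCongr e (Equiv.addRight 1)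

theorem torusShift_zpow_apply (e : Equiv.Perm Y) (n : ℤ) (p : Y × ℝ) :
    (torusShift e ^ n) p = ((e ^ n) p.1, p.2 + n) := by
  induction n generalizing p with
  | zero => simp
  | succ n ih =>
    rw [zpow_add_one, Equiv.Perm.mul_apply, ih, zpow_add_one, Equiv.Perm.mul_apply]
    refine Prod.ext rfl ?_
    simp only [torusShift, Equiv.prodCongr_apply, Prod.map, Equiv.coe_addRight]
    push_cast
    ring
  | pred n ih =>
    rw [zpow_sub_one, Equiv.Perm.mul_apply, ih, zpow_sub_one, Equiv.Perm.mul_apply]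
    refine Prod.ext rfl ?_
    simp only [torusShift, Equiv.Perm.inv_def, Equiv.prodCongr_symm, Equiv.prodCongr_apply,
      Prod.map, Equiv.addRight_symm, Equiv.coe_addRight]
    push_cast
    ring

theorem torusSubRel_torusShift_iff (e : Equiv.Perm Y) (k : ℕ) (p q : Y × ℝ) :
    torusSubRel e k p q ↔ torusSubRel e k (torusShift e p) (torusShift e q) := by
  have key (m : ℤ) (p : Y × ℝ) : ((e ^ ((k : ℤ) * m)) p.1, p.2 + (k : ℤ) * m) =
      (torusShift e ^ ((k : ℤ) * m)) p := by
    rw [torusShift_zpow_apply]; push_cast; rfl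
  refine exists_congr fun m => ?_
  rw [key, key, ← Equiv.Perm.mul_apply, ← zpow_add_one, add_comm, zpow_one_add,
    Equiv.Perm.mul_apply, (torusShift e).injective.eq_iff]

/-- The generator of the deck group of the quotient of `Y × ℝ` by `kℤ` over the mapping torus. -/
noncomputable def torusDeck (e : Equiv.Perm Y) (k : ℕ) : Equiv.Perm (Quot (torusSubRel e k)) :=
  Quot.congr (torusShift e) (torusSubRel_torusShift_iff e k)

theorem torusDeck_zpow_mk (e : Equiv.Perm Y) (k : ℕ) (n : ℤ) (p : Y × ℝ) :
    (torusDeck e k ^ n) (Quot.mk _ p) = Quot.mk _ ((e ^ n) p.1, p.2 + n) := by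
  rw [← torusShift_zpow_apply]
  induction n generalizing p with
  | zero => rfl
  | succ n ih =>
    rw [zpow_add_one, Equiv.Perm.mul_apply, zpow_add_one, Equiv.Perm.mul_apply, ← ih]
    rfl
  | pred n ih =>
    rw [zpow_sub_one, Equiv.Perm.mul_apply, zpow_sub_one, Equiv.Perm.mul_apply, ← ih]
    rfl

theorem torusDeck_zpow_mul (e : Equiv.Perm Y) (k : ℕ) (m : ℤ) :
    torusDeck e k ^ ((k : ℤ) * m) = 1 := by
  ext ⟨p⟩
  rw [torusDeck_zpow_mk]
  exact ((torusSubRel_equivalence e k).quot_mk_eq_iff _ _).2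
    ((torusSubRel_equivalence e k).symm ⟨m, by push_cast; rfl⟩)

theorem exists_of_torusDeck_zpow_mk_eq {e : Equiv.Perm Y} {k : ℕ} {n : ℤ} {p q : Y × ℝ}
    (h : (torusDeck e k ^ n) (Quot.mk _ p) = Quot.mk _ q) :
    ∃ m : ℤ, q.2 = p.2 + n + (k : ℤ) * m := by
  rw [torusDeck_zpow_mk, (torusSubRel_equivalence e k).quot_mk_eq_iff] at h
  obtain ⟨m, rfl⟩ := h
  exact ⟨m, rfl⟩

theorem orderOf_torusDeck [Nonempty Y] (e : Equiv.Perm Y) (k : ℕ) :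
    orderOf (torusDeck e k) = k := by
  refine Nat.dvd_antisymm (orderOf_dvd_of_pow_eq_one ?_) ?_
  · simpa using torusDeck_zpow_mul e k 1
  · obtain ⟨y⟩ := ‹Nonempty Y›
    have h : (torusDeck e k ^ ((orderOf (torusDeck e k) : ℕ) : ℤ)) (Quot.mk _ (y, 0)) =
        Quot.mk _ (y, 0) := by
      rw [zpow_natCast, pow_orderOf_eq_one]; rfl
    obtain ⟨m, hm⟩ := exists_of_torusDeck_zpow_mk_eq h
    rw [← Int.natCast_dvd_natCast]
    refine ⟨-m, ?_⟩
    have : (((orderOf (torusDeck e k) : ℕ) : ℤ) : ℝ) = (((k : ℤ) * -m : ℤ) : ℝ) := by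
      push_cast at hm ⊢
      linarith
    exact_mod_cast this

/-- The map from the quotient of `Y × ℝ` by `kℤ` to the mapping torus induced by the identity. -/
def torusProj (e : Equiv.Perm Y) (k : ℕ) : Quot (torusSubRel e k) → Quot (torusRel e) :=
  Quot.map id fun _ _ => torusRel_of_torusSubRel

theorem torusProj_eq_iff (e : Equiv.Perm Y) (k : ℕ) (a b : Quot (torusSubRel e k)) :
    torusProj e k a = torusProj e k b ↔
      a ∈ MulAction.orbit (Subgroup.zpowers (torusDeck e k)) b := by
  obtain ⟨p, rfl⟩ := Quot.exists_rep a
  obtain ⟨q, rfl⟩ := Quot.exists_rep b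
  rw [eq_comm]
  refine ((torusRel_equivalence e).quot_mk_eq_iff q p).trans ⟨?_, ?_⟩
  · rintro ⟨n, rfl⟩
    exact ⟨⟨_, n, rfl⟩, torusDeck_zpow_mk e k n q⟩
  · rintro ⟨⟨_, n, rfl⟩, h⟩
    have h' := (torusDeck_zpow_mk e k n q).symm.trans h
    rw [(torusSubRel_equivalence e k).quot_mk_eq_iff] at h'
    exact (torusRel_equivalence e).trans ⟨n, rfl⟩ (torusRel_of_torusSubRel h')

variable [TopologicalSpace Y]

theorem isOpen_image_mk_torusSubRel (e : Equiv.Perm Y) (k : ℕ) {V : Set ℝ} (hV : IsOpen V) :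
    IsOpen (Quot.mk (torusSubRel e k) '' (Prod.snd ⁻¹' V)) := by
  rw [← isQuotientMap_quot_mk.isOpen_preimage]
  have : Quot.mk (torusSubRel e k) ⁻¹' (Quot.mk (torusSubRel e k) '' (Prod.snd ⁻¹' V)) =
      ⋃ m : ℤ, (fun p : Y × ℝ => p.2 + (k : ℤ) * m) ⁻¹' V := by
    ext p
    simp only [Set.mem_preimage, Set.mem_image, Set.mem_iUnion]
    constructor
    · rintro ⟨q, hq, h⟩
      obtain ⟨m, rfl⟩ := ((torusSubRel_equivalence e k).quot_mk_eq_iff _ _).1 h.symm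
      exact ⟨m, hq⟩
    · rintro ⟨m, hm⟩
      exact ⟨_, hm, (Quot.sound ⟨m, rfl⟩).symm⟩
  rw [this]
  exact isOpen_iUnion fun m => hV.preimage (by fun_prop)

theorem continuous_zpow_toEquiv (f : Y ≃ₜ Y) (n : ℤ) : Continuous ⇑(f.toEquiv ^ n) := by
  induction n with
  | zero => exact continuous_id
  | succ n ih =>
    rw [zpow_add_one]
    exact ih.comp f.continuous
  | pred n ih =>
    rw [zpow_sub_one]
    exact ih.comp f.symm.continuous

theorem isQuotientCoveringMap_torusProj (f : Y ≃ₜ Y) (k : ℕ) :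
    IsQuotientCoveringMap (torusProj f.toEquiv k)
      (Subgroup.zpowers (torusDeck f.toEquiv k)) where
  toIsQuotientMap := by
    refine .of_comp continuous_quot_mk (continuous_quot_lift _ continuous_quot_mk) ?_
    exact isQuotientMap_quot_mk
  continuous_const_smul := by
    rintro ⟨_, n, rfl⟩
    rw [isQuotientMap_quot_mk.continuous_iff]
    have := continuous_zpow_toEquiv f n
    exact (continuous_quot_mk.comp (by fun_prop :
      Continuous fun p : Y × ℝ => ((f.toEquiv ^ n) p.1, p.2 + (n : ℝ)))).congr
        fun p => (torusDeck_zpow_mk f.toEquiv k n p).symm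
  apply_eq_iff_mem_orbit := torusProj_eq_iff _ _ _ _
  disjoint := by
    rintro ⟨p⟩
    refine ⟨_, (isOpen_image_mk_torusSubRel f.toEquiv k
      (Metric.isOpen_ball (x := p.2) (ε := 1 / 2))).mem_nhds ⟨p, by simp, rfl⟩, ?_⟩
    rintro ⟨_, n, rfl⟩ ⟨_, ⟨_, ⟨a, ha, rfl⟩, hab⟩, ⟨b, hb, rfl⟩⟩
    obtain ⟨m, hm⟩ := exists_of_torusDeck_zpow_mk_eq hab
    simp only [Set.mem_preimage, Metric.mem_ball, Real.dist_eq, abs_lt] at ha hb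
    have hlt : n + (k : ℤ) * m < 1 := by
      have : (n : ℝ) + (k : ℤ) * m < 1 := by linarith
      exact_mod_cast this
    have hgt : -1 < n + (k : ℤ) * m := by
      have : -1 < (n : ℝ) + (k : ℤ) * m := by linarith
      exact_mod_cast this
    have hn : n = k * -m := by rw [mul_neg]; omega
    exact Subtype.ext (by simp only [hn, torusDeck_zpow_mul, Subgroup.coe_one])

theorem card_torusProj_fiber (f : Y ≃ₜ Y) (k : ℕ) (x : Quot (torusRel f.toEquiv)) :
    Nat.card ↥(torusProj f.toEquiv k ⁻¹' {x}) = k := by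
  obtain ⟨p, rfl⟩ := Quot.exists_rep x
  have : Nonempty Y := ⟨p.1⟩
  exact (Nat.card_congr ((isQuotientCoveringMap_torusProj f k).fiberEquivGroup
    ⟨Quot.mk _ p, rfl⟩)).trans ((Nat.card_zpowers _).trans (orderOf_torusDeck _ k))

end MappingTorus

/-- For a homeomorphism `f : Y ≃ₜ Y` and `k > 0`, the quotient `Q_k` of
`Y × ℝ` by the restricted `kℤ`-action is homeomorphic to the mapping torus of `f^k`
(via `(y, t) ↦ (y, t / k)`), and the identity of `Y × ℝ` descends to a covering map
`Q_k → M_f` all of whose fibers have exactly `k` elements. -/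
theorem mappingTorus_pow_is_cyclic_cover {Y : Type*} [TopologicalSpace Y]
    (f : Y ≃ₜ Y) (k : ℕ) (hk : 0 < k) :
    (∃ h : Quot (torusSubRel f.toEquiv k) ≃ₜ Quot (torusRel (f.toEquiv ^ k)),
      ∀ p : Y × ℝ, h (Quot.mk _ p) = Quot.mk _ (p.1, p.2 / (k : ℝ))) ∧
    (∃ q : Quot (torusSubRel f.toEquiv k) → Quot (torusRel f.toEquiv),
      (∀ p : Y × ℝ, q (Quot.mk _ p) = Quot.mk _ p) ∧
      Continuous q ∧ IsCoveringMap q ∧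
      ∀ x, Nat.card ↥(q ⁻¹' {x}) = k) := by
  have hq := isQuotientCoveringMap_torusProj f k
  exact ⟨⟨torusRescale f.toEquiv hk, fun _ => rfl⟩,
    torusProj f.toEquiv k, fun _ => rfl, hq.continuous, hq.isCoveringMap,
    card_torusProj_fiber f k⟩
end

section
/- Let Y, B, F be topological spaces and let p : Y → B be a continuous map which is a fiber bundle with fiber F, in the sense that every b ∈ B has an open neighborhood U and a homeomorphism h from p⁻¹(U) to U × F such that the first-coordinate projection composed with h agrees with p on p⁻¹(U). Let f : Y ≃ₜ Y and f̄ : B ≃ₜ B be homeomorphisms satisfying p ∘ f = f̄ ∘ p. Then the map p × id : Y × ℝ → B × ℝ descends to a well-defined continuous map q : M_f → M_{f̄} between the mapping tori, and q is again a fiber bundle with fiber F in the same sense: every point of M_{f̄} has an open neighborhood V and a homeomorphism from q⁻¹(V) to V × F whose composition with the first-coordinate projection agrees with q on q⁻¹(V). -/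
/-- `p : Y → B` is a fiber bundle with fiber `F`: every point of `B` has an open
neighborhood `U` over which `p` is trivialized by a homeomorphism `p⁻¹(U) ≃ₜ U × F`
commuting with the projection to `U`. -/
def IsBundleWithFiber (F : Type*) [TopologicalSpace F] {Y B : Type*}
    [TopologicalSpace Y] [TopologicalSpace B] (p : Y → B) : Prop :=
  ∀ b : B, ∃ U : Set B, IsOpen U ∧ b ∈ U ∧
    ∃ h : (p ⁻¹' U) ≃ₜ U × F, ∀ x : p ⁻¹' U, p x = ((h x).1 : B)

/-- The orbit relation of the `ℤ`-action `n • (z, t) = (gⁿ z, t + n)` on `Z × ℝ`;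
the mapping torus of `g` is the quotient `Quot (mappingTorusRel g)`. -/
def mappingTorusRel {Z : Type*} [TopologicalSpace Z] (g : Z ≃ₜ Z)
    (p q : Z × ℝ) : Prop :=
  ∃ n : ℤ, q = ((g.toEquiv ^ n) p.1, p.2 + n)

theorem Homeomorph.continuous_toEquiv_zpow {Z : Type*} [TopologicalSpace Z] (g : Z ≃ₜ Z) (n : ℤ) :
    Continuous (g.toEquiv ^ n : Equiv.Perm Z) := by
  cases n with
  | ofNat n =>
    rw [Int.ofNat_eq_natCast, zpow_natCast, ← Equiv.Perm.iterate_eq_pow]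
    exact g.continuous.iterate n
  | negSucc n =>
    rw [zpow_negSucc, ← inv_pow, ← Equiv.Perm.iterate_eq_pow]
    exact g.symm.continuous.iterate (n + 1)

theorem mappingTorusRel_equivalence {Z : Type*} [TopologicalSpace Z] (g : Z ≃ₜ Z) :
    Equivalence (mappingTorusRel g) where
  refl x := ⟨0, by simp⟩
  symm := by
    rintro x _ ⟨n, rfl⟩
    exact ⟨-n, by simp [← Equiv.Perm.mul_apply]⟩
  trans := by
    rintro x _ _ ⟨n, rfl⟩ ⟨m, rfl⟩
    exact ⟨m + n, by simp only [zpow_add, Equiv.Perm.mul_apply]; push_cast; ring_nf⟩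

theorem mappingTorus_mk_eq_iff {Z : Type*} [TopologicalSpace Z] (g : Z ≃ₜ Z) {x y : Z × ℝ} :
    Quot.mk (mappingTorusRel g) x = Quot.mk _ y ↔ mappingTorusRel g x y := by
  rw [Quot.eq, (mappingTorusRel_equivalence g).eqvGen_iff]

theorem isOpenMap_mappingTorus_mk {Z : Type*} [TopologicalSpace Z] (g : Z ≃ₜ Z) :
    IsOpenMap (Quot.mk (mappingTorusRel g)) := by
  intro O hO
  have key : Quot.mk (mappingTorusRel g) ⁻¹' (Quot.mk (mappingTorusRel g) '' O) =
      ⋃ n : ℤ, (fun x : Z × ℝ ↦ ((g.toEquiv ^ n) x.1, x.2 + n)) ⁻¹' O := by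
    ext x
    simp only [Set.mem_preimage, Set.mem_image, Set.mem_iUnion]
    constructor
    · rintro ⟨y, hy, h⟩
      obtain ⟨n, rfl⟩ := (mappingTorus_mk_eq_iff g).1 h.symm
      exact ⟨n, hy⟩
    · rintro ⟨n, hn⟩
      exact ⟨_, hn, ((mappingTorus_mk_eq_iff g).2 ⟨n, rfl⟩).symm⟩
  rw [← isQuotientMap_quot_mk.isOpen_preimage, key]
  exact isOpen_iUnion fun n ↦ hO.preimage <|
    ((g.continuous_toEquiv_zpow n).comp continuous_fst).prodMk (continuous_snd.add_const _)

theorem isOpenEmbedding_mappingTorus_mk {Z : Type*} [TopologicalSpace Z] (g : Z ≃ₜ Z)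
    {W : Set Z} (hW : IsOpen W) (t : ℝ) :
    Topology.IsOpenEmbedding fun x : W × Set.Ioo (t - 1 / 2) (t + 1 / 2) ↦
      Quot.mk (mappingTorusRel g) ((x.1 : Z), (x.2 : ℝ)) := by
  refine .of_continuous_injective_isOpenMap ?_ ?_ ?_
  · exact continuous_quot_mk.comp (by fun_prop)
  · rintro ⟨⟨z, hz⟩, ⟨s, hs⟩⟩ ⟨⟨w, hw⟩, ⟨r, hr⟩⟩ h
    obtain ⟨n, hn⟩ := (mappingTorus_mk_eq_iff g).1 h
    simp only [Prod.mk.injEq] at hn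
    obtain ⟨rfl, rfl⟩ := hn
    have h1 : (n : ℝ) < 1 := by linarith [hs.1, hr.2]
    have h2 : (-1 : ℝ) < n := by linarith [hs.2, hr.1]
    have h3 : n < 1 := by exact_mod_cast h1
    have h4 : -1 < n := by exact_mod_cast h2
    obtain rfl : n = 0 := by omega
    simp
  · exact (isOpenMap_mappingTorus_mk g).comp
      (hW.isOpenMap_subtype_val.prodMap isOpen_Ioo.isOpenMap_subtype_val)

theorem zpow_apply_of_semiconj {Y B : Type*} {p : Y → B} {f : Equiv.Perm Y} {fbar : Equiv.Perm B}
    (hcomm : ∀ y, p (f y) = fbar (p y)) (n : ℤ) (y : Y) :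
    p ((f ^ n) y) = (fbar ^ n) (p y) := by
  induction n generalizing y with
  | zero => simp
  | succ n ih => rw [zpow_add_one, zpow_add_one, Equiv.Perm.mul_apply, ih, hcomm]; rfl
  | pred n ih =>
    rw [zpow_sub_one, zpow_sub_one, Equiv.Perm.mul_apply, ih, Equiv.Perm.mul_apply]
    congr 1
    rw [Equiv.Perm.eq_inv_iff_eq, ← hcomm,
      ← Equiv.Perm.mul_apply, mul_inv_cancel, Equiv.Perm.one_apply]

/-- The map of mapping tori induced by `p × id`, for `p` intertwining `f` and `fbar`. -/
def mappingTorusMap {Y B : Type*} [TopologicalSpace Y] [TopologicalSpace B] (p : Y → B)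
    (f : Y ≃ₜ Y) (fbar : B ≃ₜ B) (hcomm : ∀ y : Y, p (f y) = fbar (p y)) :
    Quot (mappingTorusRel f) → Quot (mappingTorusRel fbar) :=
  Quot.map (fun z ↦ (p z.1, z.2)) <| by
    rintro x _ ⟨n, rfl⟩
    exact ⟨n, by rw [← zpow_apply_of_semiconj (f := f.toEquiv) hcomm]⟩

theorem range_eq_mappingTorusMap_preimage_range {Y B : Type*} [TopologicalSpace Y] [TopologicalSpace B]
    (p : Y → B) (f : Y ≃ₜ Y) (fbar : B ≃ₜ B) (hcomm : ∀ y : Y, p (f y) = fbar (p y))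
    (U : Set B) (I : Set ℝ) :
    Set.range (fun x : (p ⁻¹' U) × I ↦ Quot.mk (mappingTorusRel f) ((x.1 : Y), (x.2 : ℝ))) =
    mappingTorusMap p f fbar hcomm ⁻¹'
      Set.range (fun x : U × I ↦ Quot.mk (mappingTorusRel fbar) ((x.1 : B), (x.2 : ℝ))) := by
  ext z
  constructor
  · rintro ⟨⟨y, s⟩, rfl⟩
    exact ⟨(⟨p y, y.2⟩, s), rfl⟩
  · induction z using Quot.ind with
    | mk z =>
      rintro ⟨⟨⟨u, hu⟩, ⟨r, hr⟩⟩, h⟩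
      obtain ⟨n, hn⟩ := (mappingTorus_mk_eq_iff fbar).1 h.symm
      simp only [Prod.mk.injEq] at hn
      obtain ⟨rfl, rfl⟩ := hn
      rw [← zpow_apply_of_semiconj (f := f.toEquiv) hcomm] at hu
      exact ⟨(⟨_, hu⟩, ⟨_, hr⟩), ((mappingTorus_mk_eq_iff f).2 ⟨n, rfl⟩).symm⟩

/-- **Lemma 2.2.** If `p : Y → B` is an `F`-bundle and `f : Y ≃ₜ Y`,
`f̄ : B ≃ₜ B` are homeomorphisms with `p ∘ f = f̄ ∘ p`, then `p × id` descends to a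
continuous map `q : M_f → M_f̄` between the mapping tori, and `q` is again an
`F`-bundle. -/
theorem mappingTorus_of_fiberPreserving_isBundle {Y B F : Type*}
    [TopologicalSpace Y] [TopologicalSpace B] [TopologicalSpace F]
    (p : Y → B) (hp : Continuous p) (hbundle : IsBundleWithFiber F p)
    (f : Y ≃ₜ Y) (fbar : B ≃ₜ B) (hcomm : ∀ y : Y, p (f y) = fbar (p y)) :
    ∃ q : Quot (mappingTorusRel f) → Quot (mappingTorusRel fbar),
      (∀ z : Y × ℝ, q (Quot.mk _ z) = Quot.mk _ (p z.1, z.2)) ∧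
      Continuous q ∧ IsBundleWithFiber F q := by
  refine ⟨mappingTorusMap p f fbar hcomm, fun _ ↦ rfl, ?_, ?_⟩
  · exact continuous_quot_lift _ (continuous_quot_mk.comp (by fun_prop))
  · intro b
    induction b using Quot.ind with
    | mk b =>
    obtain ⟨b, t⟩ := b
    obtain ⟨U, hU, hbU, h, hh⟩ := hbundle b
    have eY := isOpenEmbedding_mappingTorus_mk f (hU.preimage hp) t
    have eB := isOpenEmbedding_mappingTorus_mk fbar hU t
    refine ⟨_, eB.isOpen_range, ⟨(⟨b, hbU⟩, ⟨t, by constructor <;> linarith⟩), rfl⟩, ?_⟩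
    let hY := eY.toIsEmbedding.toHomeomorph.trans
      (Homeomorph.setCongr (range_eq_mappingTorusMap_preimage_range p f fbar hcomm U _))
    refine ⟨hY.symm.trans <| (h.prodCongr (.refl _)).trans <| (Homeomorph.prodAssoc _ _ _).trans <|
      ((Homeomorph.refl _).prodCongr (Homeomorph.prodComm _ _)).trans <|
      (Homeomorph.prodAssoc _ _ _).symm.trans <|
      eB.toIsEmbedding.toHomeomorph.prodCongr (.refl _), fun x ↦ ?_⟩
    obtain ⟨⟨y, s⟩, rfl⟩ := hY.surjective x
    simp only [Homeomorph.trans_apply, Homeomorph.symm_apply_apply]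
    exact congrArg (fun c ↦ Quot.mk (mappingTorusRel fbar) (c, (s : ℝ))) (hh y)
end

section
/- Let G be a group and φ an automorphism of G, and form the semidirect product G ⋊_φ ℤ in which the generator 1 ∈ ℤ acts on G by φ. Let V = ℚ ⊗_ℤ (Abelianization of G) be the rationalized abelianization of G, regarded as a ℚ-vector space, and let φ̄ : V → V be the ℚ-linear map induced by φ. Assume V is finite-dimensional over ℚ. Then the rationalized abelianization ℚ ⊗_ℤ (Abelianization of (G ⋊_φ ℤ)) is a finite-dimensional ℚ-vector space whose dimension equals dim_ℚ ker(φ̄ − id) + 1. -/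
open TensorProduct

/-- A homomorphism which coequalizes `φ` and the identity coequalizes each power of `φ` and the
identity. -/
theorem MonoidHom.apply_mulAut_zpow_apply {G H : Type*} [Group G] [Group H] (p : G →* H)
    (φ : MulAut G) (hp : ∀ x, p (φ x) = p x) (n : ℤ) (x : G) : p ((φ ^ n) x) = p x := by
  induction n generalizing x with
  | zero => simp
  | succ n ih => rw [zpow_add_one, MulAut.mul_apply, ih, hp]
  | pred n ih => rw [zpow_sub_one, MulAut.mul_apply, ih, ← hp, MulAut.apply_inv_self]

namespace SemidirectProduct

variable {G : Type*} [Group G] (φ : MulAut G)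

/-- The endomorphism `φ_* - id` of the abelianization of `G`, written additively. -/
def abelianizationSubId :
    Additive (Abelianization G) →ₗ[ℤ] Additive (Abelianization G) :=
  (MonoidHom.toAdditive (Abelianization.map φ.toMonoidHom)).toIntLinearMap - LinearMap.id

theorem abelianizationSubId_ofMul_of (x : G) :
    abelianizationSubId φ (Additive.ofMul (Abelianization.of x)) =
      Additive.ofMul (Abelianization.of (φ x)) - Additive.ofMul (Abelianization.of x) :=
  rfl

/-- The projection of `G` to the coinvariants of its abelianization. -/
def toCoinvariants :
    G →* Multiplicative (Additive (Abelianization G) ⧸ (abelianizationSubId φ).range) :=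
  (AddMonoidHom.toMultiplicative (abelianizationSubId φ).range.mkQ.toAddMonoidHom).comp
    (Abelianization.of : G →* Abelianization G)

theorem toCoinvariants_apply (x : G) :
    toCoinvariants φ x = Multiplicative.ofAdd
      ((abelianizationSubId φ).range.mkQ (Additive.ofMul (Abelianization.of x))) :=
  rfl

theorem toCoinvariants_apply_aut (x : G) : toCoinvariants φ (φ x) = toCoinvariants φ x := by
  rw [toCoinvariants_apply, toCoinvariants_apply, Equiv.apply_eq_iff_eq, ← sub_eq_zero, ← map_sub,
    ← abelianizationSubId_ofMul_of, Submodule.mkQ_apply, Submodule.Quotient.mk_eq_zero]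
  exact LinearMap.mem_range_self _ _

/-- The extension of `toCoinvariants` to `G ⋊ ℤ` which is trivial on `ℤ`. -/
def semidirectToCoinvariants :
    G ⋊[zpowersHom (MulAut G) φ] Multiplicative ℤ →*
      Multiplicative (Additive (Abelianization G) ⧸ (abelianizationSubId φ).range) :=
  lift (toCoinvariants φ) 1 fun n => MonoidHom.ext fun x => by
    simpa using (toCoinvariants φ).apply_mulAut_zpow_apply φ (toCoinvariants_apply_aut φ) n.toAdd x

theorem semidirectToCoinvariants_inl (x : G) :
    semidirectToCoinvariants φ (inl x) = toCoinvariants φ x :=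
  lift_inl _ _ _ x

theorem semidirectToCoinvariants_inr (n : Multiplicative ℤ) :
    semidirectToCoinvariants φ (inr n) = 1 :=
  lift_inr _ _ _ n

/-- The abelianization of `G ⋊ ℤ` maps to the coinvariants of the abelianization of `G`. -/
def abelianizationToCoinvariants :
    Additive (Abelianization (G ⋊[zpowersHom (MulAut G) φ] Multiplicative ℤ)) →ₗ[ℤ]
      Additive (Abelianization G) ⧸ (abelianizationSubId φ).range :=
  (MonoidHom.toAdditiveLeft (Abelianization.lift (semidirectToCoinvariants φ))).toIntLinearMap

/-- The abelianization of `G ⋊ ℤ` maps to `ℤ`. -/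
def abelianizationToInt :
    Additive (Abelianization (G ⋊[zpowersHom (MulAut G) φ] Multiplicative ℤ)) →ₗ[ℤ] ℤ :=
  (MonoidHom.toAdditiveLeft (Abelianization.lift rightHom)).toIntLinearMap

@[simp]
theorem abelianizationToCoinvariants_inl (x : G) :
    abelianizationToCoinvariants φ (Additive.ofMul (Abelianization.of (inl x))) =
      (abelianizationSubId φ).range.mkQ (Additive.ofMul (Abelianization.of x)) :=
  congrArg Multiplicative.toAdd (semidirectToCoinvariants_inl φ x)

@[simp]
theorem abelianizationToCoinvariants_inr (n : Multiplicative ℤ) :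
    abelianizationToCoinvariants φ (Additive.ofMul (Abelianization.of (inr n))) = 0 :=
  congrArg Multiplicative.toAdd (semidirectToCoinvariants_inr φ n)

@[simp]
theorem abelianizationToInt_inl (x : G) :
    abelianizationToInt φ (Additive.ofMul (Abelianization.of (inl x))) = 0 :=
  rfl

@[simp]
theorem abelianizationToInt_inr (n : Multiplicative ℤ) :
    abelianizationToInt φ (Additive.ofMul (Abelianization.of (inr n))) = n.toAdd :=
  rfl

theorem abelianization_of_inl_apply (x : G) :
    (Abelianization.of (inl (φ x)) :
      Abelianization (G ⋊[zpowersHom (MulAut G) φ] Multiplicative ℤ)) =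
      Abelianization.of (inl x) := by
  have h := inl_aut (φ := zpowersHom (MulAut G) φ) (Multiplicative.ofAdd 1) x
  rw [zpowersHom_apply, toAdd_ofAdd, zpow_one] at h
  rw [h, map_mul, map_mul, mul_right_comm, map_inv, map_inv, mul_inv_cancel, one_mul]

/-- The coinvariants of the abelianization of `G` map to the abelianization of `G ⋊ ℤ`. -/
def coinvariantsToAbelianization :
    (Additive (Abelianization G) ⧸ (abelianizationSubId φ).range) →ₗ[ℤ]
      Additive (Abelianization (G ⋊[zpowersHom (MulAut G) φ] Multiplicative ℤ)) :=
  (abelianizationSubId φ).range.liftQ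
    (MonoidHom.toAdditive (Abelianization.map inl)).toIntLinearMap <| by
    rw [LinearMap.range_le_ker_iff]
    refine LinearMap.ext fun x => ?_
    obtain ⟨x, rfl⟩ : ∃ y, Additive.ofMul (Abelianization.of y) = x :=
      QuotientGroup.mk_surjective x.toMul
    rw [LinearMap.comp_apply, abelianizationSubId_ofMul_of, map_sub]
    exact sub_eq_zero.2 (congrArg Additive.ofMul (abelianization_of_inl_apply φ x))

@[simp]
theorem coinvariantsToAbelianization_mkQ (x : G) :
    coinvariantsToAbelianization φ
      ((abelianizationSubId φ).range.mkQ (Additive.ofMul (Abelianization.of x))) =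
      Additive.ofMul (Abelianization.of (inl x)) :=
  rfl

/-- The abelianization of `G ⋊ ℤ` is the product of the coinvariants of the abelianization of `G`
with `ℤ`. -/
def abelianizationEquiv :
    Additive (Abelianization (G ⋊[zpowersHom (MulAut G) φ] Multiplicative ℤ)) ≃ₗ[ℤ]
      (Additive (Abelianization G) ⧸ (abelianizationSubId φ).range) × ℤ :=
  LinearEquiv.ofLinearMap ((abelianizationToCoinvariants φ).prod (abelianizationToInt φ))
    ((coinvariantsToAbelianization φ).coprod (LinearMap.toSpanSingleton ℤ _
      (Additive.ofMul (Abelianization.of (inr (Multiplicative.ofAdd 1))))))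
    (by
      refine LinearMap.prod_ext (Submodule.linearMap_qext _ (LinearMap.ext fun x => ?_))
        (LinearMap.ext_ring ?_)
      · obtain ⟨x, rfl⟩ : ∃ y, Additive.ofMul (Abelianization.of y) = x :=
          QuotientGroup.mk_surjective x.toMul
        simp [-Submodule.mkQ_apply]
      · simp)
    (by
      refine LinearMap.ext fun x => ?_
      obtain ⟨⟨g, n⟩, rfl⟩ : ∃ y, Additive.ofMul (Abelianization.of y) = x :=
        QuotientGroup.mk_surjective x.toMul
      rw [mk_eq_inl_mul_inr, map_mul, ofMul_mul, map_add, map_add]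
      simp [-Submodule.mkQ_apply, ← ofMul_zpow, ← map_zpow, ← ofAdd_zsmul])

end SemidirectProduct

/-- After base change to a field `K` over which `K ⊗ M` is finite-dimensional, the cokernel and the
kernel of an endomorphism of `M` have the same dimension. -/
theorem LinearMap.finrank_baseChange_coker {R K M : Type*} [CommRing R] [Field K] [Algebra R K]
    [AddCommGroup M] [Module R M] [FiniteDimensional K (K ⊗[R] M)] (f : M →ₗ[R] M) :
    FiniteDimensional K (K ⊗[R] (M ⧸ f.range)) ∧
      Module.finrank K (K ⊗[R] (M ⧸ f.range)) = Module.finrank K (f.baseChange K).ker := by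
  have hsurj : Function.Surjective (f.range.mkQ.baseChange K) :=
    LinearMap.lTensor_surjective K f.range.mkQ_surjective
  have hex : Function.Exact (f.baseChange K) (f.range.mkQ.baseChange K) :=
    lTensor_exact K (LinearMap.exact_map_mkQ_range f) f.range.mkQ_surjective
  refine ⟨Module.Finite.of_surjective _ hsurj, ?_⟩
  have h₁ := (f.baseChange K).finrank_range_add_finrank_ker
  have h₂ := (f.range.mkQ.baseChange K).finrank_range_add_finrank_ker
  rw [LinearMap.range_eq_top.2 hsurj, finrank_top, hex.linearMap_ker_eq] at h₂
  omega

/-- Let `φ` be an automorphism of a group `G`, and let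
`V = ℚ ⊗_ℤ (G^{ab})` be the rationalized abelianization of `G`, assumed
finite-dimensional, with `φ̄ : V → V` the induced `ℚ`-linear map. Then the rationalized
abelianization of the semidirect product `G ⋊_φ ℤ` is finite-dimensional of dimension
`dim ker(φ̄ - id) + 1`. -/
theorem finrank_rationalized_abelianization_semidirectProduct
    {G : Type*} [Group G] (φ : MulAut G)
    (hfd : FiniteDimensional ℚ (ℚ ⊗[ℤ] Additive (Abelianization G))) :
    FiniteDimensional ℚ
      (ℚ ⊗[ℤ] Additive (Abelianization (G ⋊[zpowersHom (MulAut G) φ] Multiplicative ℤ))) ∧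
    Module.finrank ℚ
      (ℚ ⊗[ℤ] Additive (Abelianization (G ⋊[zpowersHom (MulAut G) φ] Multiplicative ℤ))) =
    Module.finrank ℚ
      (LinearMap.ker
        (LinearMap.baseChange ℚ
            ((MonoidHom.toAdditive
              (Abelianization.map φ.toMonoidHom)).toIntLinearMap) -
          LinearMap.id)) + 1 := by
  obtain ⟨hfin, hrank⟩ :=
    (SemidirectProduct.abelianizationSubId φ).finrank_baseChange_coker (K := ℚ)
  rw [SemidirectProduct.abelianizationSubId, LinearMap.baseChange_sub, LinearMap.baseChange_id]
    at hrank
  let e := (SemidirectProduct.abelianizationEquiv φ).baseChange ℤ ℚ _ _ ≪≫ₗ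
    TensorProduct.prodRight ℤ ℚ ℚ _ ℤ ≪≫ₗ
    (LinearEquiv.refl ℚ _).prodCongr (TensorProduct.AlgebraTensorModule.rid ℤ ℚ ℚ)
  refine ⟨e.symm.finiteDimensional, ?_⟩
  rw [e.finrank_eq, Module.finrank_prod, Module.finrank_self, ← hrank]
  rfl
end
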